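/- arXiv:gr-qc/0108070 — 2 statements merged into one kernel-verified Lean document; each statement's English description precedes it below -/
import Mathlib

section
/- Integral identity Eq. (eqid1) of the IWM virial derivation: assume the momentum constraint ∂_j(ψ⁶ K̂_i^j) = 8π j_i ψ⁶ holds on ℝ³ with j smooth and compactly supported; assume α ψ⁶ K̂_i^j K̂_j^i and ψ⁶ j_i β^i are integrable, the vector field with components F^j := ψ⁶ K̂_i^j β^i is C¹ with integrable divergence, and its flux ∮_{S_r} F^j n_j dA tends to 0 as r → ∞. Then ∫ α ψ⁶ K̂_i^j K̂_j^i dV = −8π ∫ ψ⁶ j_i β^i dV (equivalently ∫ χ ψ⁵ K̂_i^j K̂_j^i dV = −8π ∫ √γ j_i β^i dV). -/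
noncomputable section
open MeasureTheory Filter Topology Real

abbrev E3 := EuclideanSpace ℝ (Fin 3)

/-- Partial derivative in the `i`-th coordinate direction. -/
noncomputable def pd (i : Fin 3) (f : E3 → ℝ) (x : E3) : ℝ :=
  fderiv ℝ f x (EuclideanSpace.single i 1)

/-- Flat Laplacian on `ℝ³`. -/
noncomputable def lap (f : E3 → ℝ) (x : E3) : ℝ := ∑ i, pd i (fun y => pd i f y) x

/-- Surface integral over the sphere of radius `r` (centered at the origin) of the outward
normal component of the vector field with components `F · i`. -/
noncomputable def flux (F : E3 → Fin 3 → ℝ) (r : ℝ) : ℝ :=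
  r ^ 2 * ∫ ω : Metric.sphere (0 : E3) 1,
      (∑ i, F (r • (ω : E3)) i * (ω : E3) i) ∂((volume : Measure E3).toSphere)

/-- Tracefree extrinsic curvature `K̂_i^j` built from lapse `a` and shift `β`. -/
noncomputable def Khat (a : E3 → ℝ) (β : E3 → Fin 3 → ℝ) (i j : Fin 3) (x : E3) : ℝ :=
  (1 / (2 * a x)) *
    (pd i (fun y => β y j) x + pd j (fun y => β y i) x
      - (2 / 3) * (if i = j then (1 : ℝ) else 0) * ∑ k, pd k (fun y => β y k) x)

/-- Double contraction `K̂_i^j K̂_j^i`. -/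
noncomputable def KK (a : E3 → ℝ) (β : E3 → Fin 3 → ℝ) (x : E3) : ℝ :=
  ∑ i, ∑ j, Khat a β i j x * Khat a β j i x

lemma polar_aux (g : E3 → ℝ) (hg : Integrable g) :
    ∫ x, g x = ∫ r in Set.Ioi (0:ℝ), r ^ 2 *
      ∫ ω : Metric.sphere (0 : E3) 1, g (r • (ω : E3)) ∂((volume : Measure E3).toSphere) := by
  have hd : Module.finrank ℝ E3 - 1 = 2 := by simp
  have mp := (volume : Measure E3).measurePreserving_homeomorphUnitSphereProd
  rw [hd] at mp
  let G : Metric.sphere (0 : E3) 1 × Set.Ioi (0:ℝ) → ℝ := fun p => g ((p.2 : ℝ) • (p.1 : E3))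
  have hG : ∀ x : ({(0)}ᶜ : Set E3), G (homeomorphUnitSphereProd E3 x) = g x := by
    intro x
    have hx : ‖(x : E3)‖ ≠ 0 := by
      exact norm_ne_zero_iff.2 x.2
    simp only [G, homeomorphUnitSphereProd_apply_snd_coe, homeomorphUnitSphereProd_apply_fst_coe]
    rw [smul_smul, mul_inv_cancel₀ hx, one_smul]
  have h1 : ∫ x, g x = ∫ x : ({(0)}ᶜ : Set E3), g x ∂((volume : Measure E3).comap (↑)) := by
    rw [integral_subtype_comap (measurableSet_singleton _).compl fun x ↦ g x,
      restrict_compl_singleton]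
  have h2 : ∫ x : ({(0)}ᶜ : Set E3), g x ∂((volume : Measure E3).comap (↑))
      = ∫ p, G p ∂((volume : Measure E3).toSphere.prod (.volumeIoiPow 2)) := by
    rw [← mp.integral_comp (Homeomorph.measurableEmbedding _) G]
    exact integral_congr_ae (.of_forall fun x => (hG x).symm)
  have hGi : Integrable G ((volume : Measure E3).toSphere.prod (.volumeIoiPow 2)) := by
    rw [← mp.integrable_comp_emb (Homeomorph.measurableEmbedding _)]
    have : G ∘ (homeomorphUnitSphereProd E3) = g ∘ (Subtype.val : ({(0)}ᶜ : Set E3) → E3) := by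
      funext x; exact hG x
    rw [this, ← integrableOn_iff_comap_subtypeVal (measurableSet_singleton _).compl]
    exact hg.integrableOn
  rw [h1, h2, integral_prod_symm _ hGi]
  simp only [Measure.volumeIoiPow, ENNReal.ofReal]
  rw [integral_withDensity_eq_integral_smul
    ((measurable_subtype_coe.pow_const _).real_toNNReal)]
  simp only [G]
  rw [integral_subtype_comap measurableSet_Ioi fun a ↦ Real.toNNReal (a ^ 2) •
      ∫ ω : Metric.sphere (0 : E3) 1, g (a • (ω : E3)) ∂((volume : Measure E3).toSphere)]
  refine setIntegral_congr_fun measurableSet_Ioi fun x hx ↦ ?_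
  simp only [NNReal.smul_def, Real.coe_toNNReal _ (sq_nonneg x), smul_eq_mul]

/-- Radial cutoff. -/
def cutoff (c : ℝ) (x : E3) : ℝ := Real.smoothTransition (c - ‖x‖ ^ 2)

lemma cutoff_contDiff (c : ℝ) : ContDiff ℝ 1 (cutoff c) := by
  have h : ContDiff ℝ 1 Real.smoothTransition := Real.smoothTransition.contDiff (n := 1)
  exact h.comp (contDiff_const.sub (contDiff_norm_sq ℝ))

lemma cutoff_compact (c : ℝ) (hc : 0 ≤ c) : HasCompactSupport (cutoff c) := by
  refine HasCompactSupport.intro (isCompact_closedBall (0:E3) (c+1)) ?_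
  intro x hx
  have hx : c + 1 < ‖x‖ := by simpa using hx
  refine Real.smoothTransition.zero_of_nonpos ?_
  nlinarith

lemma st_hasDeriv (t : ℝ) :
    HasDerivAt Real.smoothTransition (deriv Real.smoothTransition t) t :=
  ((Real.smoothTransition.contDiff (n := 1)).differentiable (by simp) t).hasDerivAt

lemma cutoff_pd (c : ℝ) (l : Fin 3) (x : E3) :
    pd l (cutoff c) x = -(2 * x l * deriv Real.smoothTransition (c - ‖x‖ ^ 2)) := by
  have h1 : HasFDerivAt (fun y : E3 => c - ‖y‖ ^ 2) (-(2 • (innerSL ℝ x))) x := by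
    simpa using (hasStrictFDerivAt_norm_sq x).hasFDerivAt.const_sub c
  have h2 := (st_hasDeriv (c - ‖x‖ ^ 2)).comp_hasFDerivAt x h1
  have h3 : HasFDerivAt (cutoff c) _ x := h2
  rw [pd, h3.fderiv]
  simp [EuclideanSpace.inner_single_right]
  ring

lemma radial_bound (f : ℝ → ℝ) (R ε : ℝ) (hR : 0 ≤ R) (hε : 0 ≤ ε)
    (hf : ∀ r, R ≤ r → |f r| ≤ ε) (c : ℝ) (hc : R ^ 2 + 1 ≤ c) :
    |∫ r in Set.Ioi (0:ℝ), 2 * r * deriv Real.smoothTransition (c - r ^ 2) * f r| ≤ ε := by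
  have hnn : ∀ t, 0 ≤ deriv Real.smoothTransition t := fun t =>
    Real.smoothTransition.monotone.deriv_nonneg
  have hder : ∀ r ∈ Set.Ici (0:ℝ), HasDerivAt (fun r => - Real.smoothTransition (c - r ^ 2))
      (2 * r * deriv Real.smoothTransition (c - r ^ 2)) r := by
    intro r _
    have h1 : HasDerivAt (fun r : ℝ => c - r ^ 2) (-(2 * r)) r := by
      simpa using (hasDerivAt_pow 2 r).const_sub c
    have := ((st_hasDeriv (c - r ^ 2)).comp r h1).neg
    convert! this using 1
    ring
  have hpos : ∀ r ∈ Set.Ioi (0:ℝ), 0 ≤ 2 * r * deriv Real.smoothTransition (c - r ^ 2) := by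
    intro r hr
    have : (0:ℝ) < r := hr
    have := hnn (c - r ^ 2)
    positivity
  have hlim : Tendsto (fun r : ℝ => - Real.smoothTransition (c - r ^ 2)) atTop (𝓝 0) := by
    refine tendsto_const_nhds.congr' ?_
    filter_upwards [eventually_ge_atTop (c + 1)] with r hr
    rw [Real.smoothTransition.zero_of_nonpos (by nlinarith [sq_nonneg R]), neg_zero]
  have hi := integrableOn_Ioi_deriv_of_nonneg' hder hpos hlim
  have hI := integral_Ioi_of_hasDerivAt_of_nonneg' hder hpos hlim
  have key := norm_integral_le_of_norm_le (μ := volume.restrict (Set.Ioi (0:ℝ)))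
    (f := fun r => 2 * r * deriv Real.smoothTransition (c - r ^ 2) * f r)
    (g := fun r => 2 * r * deriv Real.smoothTransition (c - r ^ 2) * ε) (hi.mul_const ε) ?_
  · rw [integral_mul_const, hI] at key
    refine key.trans ?_
    have := Real.smoothTransition.le_one (c - 0 ^ 2)
    nlinarith
  · filter_upwards [ae_restrict_mem measurableSet_Ioi] with r hr
    have hr0 : (0:ℝ) < r := hr
    rw [norm_mul, Real.norm_of_nonneg (hpos r hr)]
    by_cases hrR : R ≤ r
    · exact mul_le_mul_of_nonneg_left (hf r hrR) (hpos r hr)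
    · have h1 : 1 < c - r ^ 2 := by nlinarith
      have : deriv Real.smoothTransition (c - r ^ 2) = 0 := by
        have : Real.smoothTransition =ᶠ[𝓝 (c - r ^ 2)] fun _ => (1:ℝ) := by
          filter_upwards [lt_mem_nhds h1] with t ht
          exact Real.smoothTransition.one_of_one_le ht.le
        rw [this.deriv_eq]; simp
      simp [this]

lemma div_cutoff (F : E3 → Fin 3 → ℝ) (hF : ∀ l, ContDiff ℝ 1 fun x => F x l)
    (c : ℝ) (hc : 0 ≤ c) :
    ∫ x, cutoff c x * ∑ l, pd l (fun y => F y l) x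
      = ∫ r in Set.Ioi (0:ℝ), 2 * r * deriv Real.smoothTransition (c - r ^ 2) * flux F r := by
  have hcs := cutoff_compact c hc
  have hcd := cutoff_contDiff c
  have pdc : ∀ (f : E3 → ℝ) l, ContDiff ℝ 1 f → Continuous (pd l f) := by
    intro f l hf
    exact (hf.continuous_fderiv (by simp)).clm_apply continuous_const
  have hcs' : ∀ l, HasCompactSupport (pd l (cutoff c)) := fun l => hcs.fderiv_apply ℝ _
  have i1 : ∀ l, Integrable fun x => pd l (cutoff c) x * F x l := fun l =>
    ((pdc _ l hcd).mul (hF l).continuous).integrable_of_hasCompactSupport (hcs' l).mul_right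
  have i2 : ∀ l, Integrable fun x => cutoff c x * pd l (fun y => F y l) x := fun l =>
    (hcd.continuous.mul (pdc _ l (hF l))).integrable_of_hasCompactSupport hcs.mul_right
  have i3 : ∀ l, Integrable fun x => cutoff c x * F x l := fun l =>
    (hcd.continuous.mul (hF l).continuous).integrable_of_hasCompactSupport hcs.mul_right
  have parts : ∀ l, ∫ x, cutoff c x * pd l (fun y => F y l) x
      = - ∫ x, pd l (cutoff c) x * F x l := fun l =>
    integral_mul_fderiv_eq_neg_fderiv_mul_of_integrable (i1 l) (i2 l) (i3 l)
      (fun x _ => hcd.differentiable (by simp) x) (fun x _ => (hF l).differentiable (by simp) x)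
  simp only [Finset.mul_sum]
  rw [integral_finsetSum _ fun l _ => i2 l]
  simp only [parts]
  rw [Finset.sum_neg_distrib, ← integral_finsetSum _ fun l _ => i1 l,
    polar_aux _ (integrable_finsetSum _ fun l _ => i1 l), ← integral_neg]
  refine setIntegral_congr_fun measurableSet_Ioi fun r hr ↦ ?_
  have hr0 : (0:ℝ) < r := hr
  simp only [flux]
  rw [mul_left_comm, ← mul_neg, ← integral_neg]
  congr 1
  rw [← integral_const_mul]
  refine integral_congr_ae (.of_forall fun ω => ?_)
  have hω : ‖r • (ω : E3)‖ = r := by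
    rw [norm_smul, norm_eq_of_mem_sphere, mul_one, Real.norm_of_nonneg hr0.le]
  simp only [cutoff_pd, hω]
  rw [Finset.mul_sum, ← Finset.sum_neg_distrib]
  refine Finset.sum_congr rfl fun l _ => ?_
  simp
  ring

lemma integral_div_eq_zero (F : E3 → Fin 3 → ℝ) (hF : ∀ l, ContDiff ℝ 1 fun x => F x l)
    (hdiv : Integrable fun x => ∑ l, pd l (fun y => F y l) x)
    (hflux : Tendsto (flux F) atTop (𝓝 0)) :
    ∫ x, ∑ l, pd l (fun y => F y l) x = 0 := by
  have t1 : Tendsto (fun c => ∫ x, cutoff c x * ∑ l, pd l (fun y => F y l) x) atTop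
      (𝓝 (∫ x, ∑ l, pd l (fun y => F y l) x)) := by
    refine tendsto_integral_filter_of_dominated_convergence
      (fun x => ‖∑ l, pd l (fun y => F y l) x‖) ?_ ?_ hdiv.norm ?_
    · exact .of_forall fun c => (cutoff_contDiff c).continuous.aestronglyMeasurable.mul hdiv.1
    · refine .of_forall fun c => .of_forall fun x => ?_
      rw [norm_mul]
      refine mul_le_of_le_one_left (norm_nonneg _) ?_
      rw [cutoff, Real.norm_of_nonneg (Real.smoothTransition.nonneg _)]
      exact Real.smoothTransition.le_one _
    · refine .of_forall fun x => tendsto_const_nhds.congr' ?_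
      filter_upwards [eventually_ge_atTop (‖x‖ ^ 2 + 1)] with c hc
      rw [cutoff, Real.smoothTransition.one_of_one_le (by linarith), one_mul]
  have t2 : Tendsto (fun c => ∫ x, cutoff c x * ∑ l, pd l (fun y => F y l) x) atTop (𝓝 0) := by
    rw [Metric.tendsto_atTop]
    intro ε hε
    obtain ⟨R, hR⟩ := (Metric.tendsto_atTop.1 hflux) (ε / 2) (by positivity)
    refine ⟨(max R 0) ^ 2 + 1, fun c hc => ?_⟩
    have hc : (max R 0) ^ 2 + 1 ≤ c := hc
    rw [div_cutoff F hF c (by nlinarith [sq_nonneg (max R 0)]), dist_zero_right, Real.norm_eq_abs]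
    refine (radial_bound (flux F) (max R 0) (ε / 2) (le_max_right _ _) (by positivity)
      (fun r hr => ?_) c hc).trans_lt (by linarith)
    have := hR r ((le_max_left _ _).trans hr)
    rw [dist_zero_right, Real.norm_eq_abs] at this
    exact this.le
  exact tendsto_nhds_unique t1 t2

lemma pd_contDiff (f : E3 → ℝ) (hf : ContDiff ℝ (⊤ : ℕ∞) f) (l : Fin 3) :
    ContDiff ℝ 1 (pd l f) := by
  have : ContDiff ℝ 1 (fderiv ℝ f) := by
    refine hf.fderiv_right ?_
    have : ((2 : ℕ∞) : WithTop ℕ∞) ≤ ((⊤ : ℕ∞) : WithTop ℕ∞) := by exact_mod_cast le_top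
    convert! this using 1
  exact this.clm_apply contDiff_const

lemma Khat_contDiff (α : E3 → ℝ) (β : E3 → Fin 3 → ℝ) (hα : ∀ x, 0 < α x)
    (hαC : ContDiff ℝ (⊤ : ℕ∞) α) (hβC : ∀ i, ContDiff ℝ (⊤ : ℕ∞) fun x => β x i)
    (i j : Fin 3) : ContDiff ℝ 1 (Khat α β i j) := by
  have hα1 : ContDiff ℝ 1 α := hαC.of_le (by exact_mod_cast le_top)
  have h := fun i j => pd_contDiff _ (hβC i) j
  refine ContDiff.mul ?_ (((h j i).add (h i j)).sub
    (contDiff_const.mul (ContDiff.sum fun k _ => h k k)))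
  exact contDiff_const.div (contDiff_const.mul hα1) fun x => by have := hα x; positivity

lemma K_contract (α : E3 → ℝ) (β : E3 → Fin 3 → ℝ) (x : E3) (hα : 0 < α x) :
    ∑ l, ∑ i, Khat α β i l x * pd l (fun y => β y i) x = α x * KK α β x := by
  simp only [KK, Khat, Fin.sum_univ_three]
  simp
  field_simp
  ring

lemma div_expand (α ψ : E3 → ℝ) (β : E3 → Fin 3 → ℝ) (j : E3 → Fin 3 → ℝ)
    (hα : ∀ x, 0 < α x)
    (hαC : ContDiff ℝ (⊤ : ℕ∞) α) (hψC : ContDiff ℝ (⊤ : ℕ∞) ψ)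
    (hβC : ∀ i, ContDiff ℝ (⊤ : ℕ∞) fun x => β x i)
    (hmom : ∀ x : E3, ∀ i : Fin 3,
      (∑ l, pd l (fun y => ψ y ^ 6 * Khat α β i l y) x) = 8 * π * j x i * ψ x ^ 6) (x : E3) :
    ∑ l, pd l (fun y => ψ y ^ 6 * ∑ i, Khat α β i l y * β y i) x
      = α x * ψ x ^ 6 * KK α β x + 8 * π * (ψ x ^ 6 * ∑ i, j x i * β x i) := by
  have hd : ∀ i l, DifferentiableAt ℝ (fun y => ψ y ^ 6 * Khat α β i l y) x := fun i l =>
    ((hψC.differentiable (by simp) x).pow 6).mul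
      ((Khat_contDiff α β hα hαC hβC i l).differentiable (by simp) x)
  have hb : ∀ i, DifferentiableAt ℝ (fun y => β y i) x := fun i =>
    (hβC i).differentiable (by simp) x
  have h1 : ∀ l, pd l (fun y => ψ y ^ 6 * ∑ i, Khat α β i l y * β y i) x
      = ∑ i, (pd l (fun y => ψ y ^ 6 * Khat α β i l y) x * β x i
        + ψ x ^ 6 * (Khat α β i l x * pd l (fun y => β y i) x)) := by
    intro l
    have e : (fun y => ψ y ^ 6 * ∑ i, Khat α β i l y * β y i)
        = fun y => ∑ i, (ψ y ^ 6 * Khat α β i l y) * β y i := by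
      funext y; rw [Finset.mul_sum]; simp only [mul_assoc]
    have h := HasFDerivAt.fun_sum (u := Finset.univ)
      (fun (i : Fin 3) _ => (hd i l).hasFDerivAt.fun_mul (hb i).hasFDerivAt)
    rw [pd, e, HasFDerivAt.fderiv h]
    rw [ContinuousLinearMap.sum_apply]
    refine Finset.sum_congr rfl fun i _ => ?_
    simp only [ContinuousLinearMap.add_apply, ContinuousLinearMap.smul_apply, smul_eq_mul, pd]
    ring
  simp only [h1, Finset.sum_add_distrib]
  have h2 : ∑ l, ∑ i, pd l (fun y => ψ y ^ 6 * Khat α β i l y) x * β x i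
      = 8 * π * (ψ x ^ 6 * ∑ i, j x i * β x i) := by
    rw [Finset.sum_comm]
    simp only [← Finset.sum_mul, hmom, Finset.mul_sum]
    exact Finset.sum_congr rfl fun i _ => by ring
  have h3 : ∑ l, ∑ i, ψ x ^ 6 * (Khat α β i l x * pd l (fun y => β y i) x)
      = α x * ψ x ^ 6 * KK α β x := by
    simp only [← Finset.mul_sum]
    rw [K_contract α β x (hα x)]; ring
  rw [h2, h3, add_comm]

/-- Integral identity Eq. (eqid1) of the IWM virial derivation:
under the momentum constraint and decay of the flux of `F^j = ψ⁶ K̂_i^j β^i` at infinity,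
`∫ α ψ⁶ K̂_i^j K̂_j^i dV = −8π ∫ ψ⁶ j_i β^i dV`. -/
theorem iwm_eqid1
    (α ψ : E3 → ℝ) (β : E3 → Fin 3 → ℝ) (j : E3 → Fin 3 → ℝ)
    (hα : ∀ x, 0 < α x) (hψ : ∀ x, 0 < ψ x)
    (hαC : ContDiff ℝ (⊤ : ℕ∞) α) (hψC : ContDiff ℝ (⊤ : ℕ∞) ψ)
    (hβC : ∀ i, ContDiff ℝ (⊤ : ℕ∞) fun x => β x i)
    (hjC : ∀ i, ContDiff ℝ (⊤ : ℕ∞) fun x => j x i)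
    (hjsupp : ∀ i, HasCompactSupport fun x => j x i)
    -- momentum constraint ∂_j(ψ⁶ K̂_i^j) = 8π j_i ψ⁶
    (hmom : ∀ x : E3, ∀ i : Fin 3,
      (∑ l, pd l (fun y => ψ y ^ 6 * Khat α β i l y) x) = 8 * π * j x i * ψ x ^ 6)
    -- integrability of the displayed integrands
    (hint1 : Integrable fun x => α x * ψ x ^ 6 * KK α β x)
    (hint2 : Integrable fun x => ψ x ^ 6 * ∑ i, j x i * β x i)
    -- F is C¹ with integrable divergence
    (hF : ∀ l, ContDiff ℝ 1 fun x => ψ x ^ 6 * ∑ i, Khat α β i l x * β x i)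
    (hdiv : Integrable fun x =>
      ∑ l, pd l (fun y => ψ y ^ 6 * ∑ i, Khat α β i l y * β y i) x)
    -- the flux of F over S_r tends to 0 as r → ∞
    (hflux : Tendsto (flux fun x l => ψ x ^ 6 * ∑ i, Khat α β i l x * β x i)
      atTop (𝓝 0)) :
    (∫ x : E3, α x * ψ x ^ 6 * KK α β x)
      = -(8 * π) * ∫ x : E3, ψ x ^ 6 * ∑ i, j x i * β x i := by
  have h0 := integral_div_eq_zero
    (fun x l => ψ x ^ 6 * ∑ i, Khat α β i l x * β x i) hF hdiv hflux
  simp only [div_expand α ψ β j hα hαC hψC hβC hmom] at h0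
  rw [integral_add hint1 (hint2.const_mul _), integral_const_mul] at h0
  linarith
end
end

section
/- Mass-difference formula (Eq. eqdiff2 combined with eqid1): assume the Hamiltonian constraint Δψ = −2π ψ⁵ ρ_H − (ψ⁵/8) K̂_i^j K̂_j^i, the slicing equation Δχ = 2π χ ψ⁴ (ρ_H + 2S) + (7/8) χ ψ⁴ K̂_i^j K̂_j^i where S := j_k (v^k + β^k)/α + 3P, and the momentum constraint ∂_j(ψ⁶ K̂_i^j) = 8π j_i ψ⁶, with ρ_H, j, P, v smooth and compactly supported. Assume the flux limits M_χ := (1/2π) lim_{r→∞} ∮_{S_r} ψ (∇χ·n) dA and M_ADM := −(1/2π) lim_{r→∞} ∮_{S_r} χ (∇ψ·n) dA exist, the flux of the vector field ψ⁶ K̂_i^j β^i (in the index j) vanishes at infinity, and all displayed integrands are integrable. Then M_χ − M_ADM = 2 ∫ [ ψ⁶ ( j_k v^k + 3 α P ) − (1/2) ψ⁶ j_k β^k + (1/2π) ∇ψ·∇χ ] dV. -/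
noncomputable section
open MeasureTheory Filter Topology Real

/-- `χ := αψ`. -/
noncomputable def chi (α ψ : E3 → ℝ) (x : E3) : ℝ := α x * ψ x

lemma polar_integral (h : E3 → ℝ) (hh : Integrable h) :
    ∫ x, h x = ∫ r in Set.Ioi (0 : ℝ), r ^ 2 *
      ∫ ω : Metric.sphere (0 : E3) 1, h (r • (ω : E3)) ∂((volume : Measure E3).toSphere) := by
  have hdim : Module.finrank ℝ E3 - 1 = 2 := by simp
  have hmp := (volume : Measure E3).measurePreserving_homeomorphUnitSphereProd
  rw [hdim] at hmp
  have hemb := (homeomorphUnitSphereProd E3).measurableEmbedding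
  have hcomp : ∀ x : ({(0 : E3)}ᶜ : Set E3),
      h ((homeomorphUnitSphereProd E3 x).2.1 • (homeomorphUnitSphereProd E3 x).1.1) = h x := by
    intro x
    congr 1
    have hx : ‖(x : E3)‖ ≠ 0 := norm_ne_zero_iff.2 x.2
    simp [smul_smul, hx]
  have hint : Integrable (fun p : Metric.sphere (0 : E3) 1 × Set.Ioi (0 : ℝ) => h (p.2.1 • p.1.1))
      (((volume : Measure E3).toSphere).prod (Measure.volumeIoiPow 2)) := by
    rw [← hmp.integrable_comp_emb hemb]
    have : Integrable (fun x : ({(0 : E3)}ᶜ : Set E3) => h x)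
        ((volume : Measure E3).comap (↑)) := by
      have := hh.integrableOn (s := ({(0 : E3)}ᶜ : Set E3))
      rwa [integrableOn_iff_comap_subtypeVal (measurableSet_singleton _).compl] at this
    exact this.congr (Eventually.of_forall fun x => (hcomp x).symm)
  calc
    ∫ x, h x = ∫ x : ({(0)}ᶜ : Set E3), h x ∂((volume : Measure E3).comap (↑)) := by
      rw [integral_subtype_comap (measurableSet_singleton _).compl fun x ↦ h x,
        restrict_compl_singleton]
    _ = ∫ p : Metric.sphere (0 : E3) 1 × Set.Ioi (0 : ℝ), h (p.2.1 • p.1.1)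
          ∂(((volume : Measure E3).toSphere).prod (Measure.volumeIoiPow 2)) := by
      rw [← hmp.integral_comp hemb]
      exact integral_congr_ae (Eventually.of_forall fun x => (hcomp x).symm)
    _ = ∫ r : Set.Ioi (0 : ℝ), (∫ ω : Metric.sphere (0 : E3) 1, h (r.1 • (ω : E3))
          ∂((volume : Measure E3).toSphere)) ∂(Measure.volumeIoiPow 2) :=
      integral_prod_symm _ hint
    _ = _ := by
      simp only [Measure.volumeIoiPow, ENNReal.ofReal]
      rw [integral_withDensity_eq_integral_smul,
        integral_subtype_comap measurableSet_Ioi fun a : ℝ ↦ Real.toNNReal (a ^ 2) •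
          ∫ ω : Metric.sphere (0 : E3) 1, h (a • (ω : E3)) ∂((volume : Measure E3).toSphere),
        setIntegral_congr_fun measurableSet_Ioi fun x hx ↦ ?_]
      · simp only [NNReal.smul_def, Real.coe_toNNReal _ (sq_nonneg x), smul_eq_mul]
      · exact (measurable_subtype_coe.pow_const _).real_toNNReal

/-- A smooth cutoff: `1` for `t ≤ 1`, `0` for `t ≥ 2`. -/
def cut (t : ℝ) : ℝ := Real.smoothTransition (2 - t)

lemma cut_contDiff : ContDiff ℝ 1 cut := by
  unfold cut
  exact (Real.smoothTransition.contDiff (n := 1)).comp (contDiff_const.sub contDiff_id)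

lemma cut_one {t : ℝ} (h : t ≤ 1) : cut t = 1 :=
  Real.smoothTransition.one_of_one_le (by linarith)

lemma cut_zero {t : ℝ} (h : 2 ≤ t) : cut t = 0 :=
  Real.smoothTransition.zero_of_nonpos (by linarith)

lemma cut_abs_le (t : ℝ) : ‖cut t‖ ≤ 1 := by
  unfold cut
  rw [Real.norm_eq_abs, abs_of_nonneg (Real.smoothTransition.nonneg _)]
  exact Real.smoothTransition.le_one _

lemma cut_deriv_lt {t : ℝ} (h : t < 1) : deriv cut t = 0 := by
  have : cut =ᶠ[𝓝 t] fun _ => 1 := by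
    filter_upwards [Iio_mem_nhds h] with s hs using cut_one (le_of_lt hs)
  rw [this.deriv_eq]; simp

lemma cut_deriv_gt {t : ℝ} (h : 2 < t) : deriv cut t = 0 := by
  have : cut =ᶠ[𝓝 t] fun _ => 0 := by
    filter_upwards [Ioi_mem_nhds h] with s hs using cut_zero (le_of_lt hs)
  rw [this.deriv_eq]; simp

/-- derivative of `s ↦ cut (s²)`. -/
def Dc (s : ℝ) : ℝ := deriv cut (s ^ 2) * (2 * s)

lemma Dc_cont : Continuous Dc := by
  have := cut_contDiff.continuous_deriv le_rfl
  unfold Dc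
  fun_prop

lemma Dc_zero_lt {s : ℝ} (h0 : 0 < s) (h : s < 1) : Dc s = 0 := by
  unfold Dc
  rw [cut_deriv_lt (by nlinarith)]; simp

lemma Dc_compact : HasCompactSupport Dc := by
  refine HasCompactSupport.intro (isCompact_Icc (a := (-2 : ℝ)) (b := 2)) ?_
  intro s hs
  unfold Dc
  rw [cut_deriv_gt, zero_mul]
  simp only [Set.mem_Icc, not_and_or, not_le] at hs
  rcases hs with h | h <;> nlinarith

lemma Dc_integrable : Integrable Dc := Dc_cont.integrable_of_hasCompactSupport Dc_compact

lemma Dc_hasDeriv (s : ℝ) : HasDerivAt (fun s => cut (s ^ 2)) (Dc s) s := by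
  have h1 : HasDerivAt cut (deriv cut (s ^ 2)) (s ^ 2) :=
    ((cut_contDiff.differentiable one_ne_zero) _).hasDerivAt
  have h2 : HasDerivAt (fun s : ℝ => s ^ 2) (2 * s) s := by simpa using hasDerivAt_pow 2 s
  exact HasDerivAt.comp (h₂ := cut) (h := fun s : ℝ => s ^ 2) s h1 h2

lemma Dc_integral : ∫ s in Set.Ioi (0 : ℝ), Dc s = -1 := by
  have : Tendsto (fun s : ℝ => cut (s ^ 2)) atTop (𝓝 0) := by
    refine tendsto_const_nhds.congr' ?_
    filter_upwards [eventually_ge_atTop (2 : ℝ)] with s hs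
    exact (cut_zero (by nlinarith)).symm
  rw [integral_Ioi_of_hasDerivAt_of_tendsto' (fun x _ => Dc_hasDeriv x) Dc_integrable.integrableOn
    this, cut_one (by norm_num)]
  norm_num

lemma flux_meas (F : E3 → Fin 3 → ℝ) (hF : ∀ i, Continuous fun x => F x i) :
    StronglyMeasurable (flux F) := by
  unfold flux
  refine StronglyMeasurable.mul (by fun_prop) ?_
  refine StronglyMeasurable.integral_prod_right
    (f := fun (r : ℝ) (ω : Metric.sphere (0 : E3) 1) => ∑ i, F (r • (ω : E3)) i * (ω : E3) i) ?_
  apply Continuous.stronglyMeasurable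
  have : ∀ i, Continuous fun p : ℝ × Metric.sphere (0 : E3) 1 => F (p.1 • (p.2 : E3)) i :=
    fun i => (hF i).comp (by fun_prop)
  simp only [Function.uncurry_def]
  fun_prop

lemma flux_avg (F : E3 → Fin 3 → ℝ) (hF : ∀ i, Continuous fun x => F x i) (L : ℝ)
    (hL : Tendsto (flux F) atTop (𝓝 L)) :
    Tendsto (fun R : ℝ => ∫ s in Set.Ioi (0 : ℝ), Dc s * flux F (R * s)) atTop (𝓝 (-L)) := by
  have hlim : -L = ∫ s in Set.Ioi (0 : ℝ), Dc s * L := by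
    rw [integral_mul_const, Dc_integral]; ring
  rw [hlim]
  have hb : ∀ᶠ r in atTop, |flux F r| ≤ |L| + 1 := by
    have := hL.abs.eventually (gt_mem_nhds (show |L| < |L| + 1 by linarith))
    exact this.mono fun _ h => le_of_lt h
  obtain ⟨R0, hR0⟩ := eventually_atTop.1 hb
  refine tendsto_integral_filter_of_dominated_convergence (fun s => ‖Dc s‖ * (|L| + 1)) ?_ ?_ ?_ ?_
  · refine Eventually.of_forall fun R => ?_
    exact (Dc_cont.stronglyMeasurable.mul
      ((flux_meas F hF).comp_measurable (by fun_prop))).aestronglyMeasurable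
  · filter_upwards [eventually_ge_atTop R0, eventually_ge_atTop 0] with R hR hR'
    filter_upwards [ae_restrict_mem measurableSet_Ioi] with s hs
    rw [norm_mul]
    by_cases h1 : s < 1
    · rw [Dc_zero_lt hs h1]; simp
    · gcongr
      apply hR0
      nlinarith
  · exact (Dc_integrable.norm.mul_const _).integrableOn
  · filter_upwards [ae_restrict_mem measurableSet_Ioi] with s hs
    exact (hL.comp (tendsto_id.atTop_mul_const hs)).const_mul _

/-- The cutoff on space at scale `R`. -/
def cutR (R : ℝ) (x : E3) : ℝ := cut ((∑ i, x i ^ 2) / R ^ 2)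

lemma cutR_contDiff (R : ℝ) : ContDiff ℝ 1 (cutR R) := by
  unfold cutR
  refine cut_contDiff.comp ?_
  refine ContDiff.div_const ?_ _
  fun_prop

lemma sum_sq_eq (x : E3) : ∑ i, x i ^ 2 = ‖x‖ ^ 2 := by
  rw [EuclideanSpace.norm_sq_eq]; simp

lemma cutR_compact {R : ℝ} (hR : 0 < R) : HasCompactSupport (cutR R) := by
  refine HasCompactSupport.intro (isCompact_closedBall (0 : E3) (2 * R)) ?_
  intro x hx
  simp only [Metric.mem_closedBall, dist_zero_right, not_le] at hx
  apply cut_zero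
  rw [sum_sq_eq, le_div_iff₀ (by positivity)]
  nlinarith

lemma cutR_pd (R : ℝ) (i : Fin 3) (x : E3) :
    pd i (cutR R) x = deriv cut ((∑ i, x i ^ 2) / R ^ 2) * (2 * x i / R ^ 2) := by
  have h1 : HasDerivAt cut (deriv cut ((∑ i, x i ^ 2) / R ^ 2)) ((∑ i, x i ^ 2) / R ^ 2) :=
    ((cut_contDiff.differentiable one_ne_zero) _).hasDerivAt
  have h3 : ∀ k, HasFDerivAt (fun x : E3 => x k) (EuclideanSpace.proj k : E3 →L[ℝ] ℝ) x :=
    fun k => (EuclideanSpace.proj k : E3 →L[ℝ] ℝ).hasFDerivAt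
  have h2 := (HasFDerivAt.fun_sum (u := Finset.univ) (fun k _ => (h3 k).pow 2)).mul_const
    ((R ^ 2)⁻¹)
  have h4 := h1.comp_hasFDerivAt x (f := fun x : E3 => (∑ i, x i ^ 2) / R ^ 2)
    (by simpa only [div_eq_mul_inv] using h2)
  unfold pd
  have h5 : fderiv ℝ (cutR R) x = _ := h4.fderiv
  rw [h5]
  generalize deriv cut ((∑ i, x i ^ 2) / R ^ 2) = d
  fin_cases i <;> simp [Fin.sum_univ_three, -mul_eq_mul_left_iff] <;> ring

lemma pd_continuous {f : E3 → ℝ} (hf : ContDiff ℝ 1 f) (i : Fin 3) : Continuous (pd i f) := by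
  unfold pd
  exact (hf.continuous_fderiv one_ne_zero).clm_apply continuous_const

lemma cutR_ibp (F : E3 → Fin 3 → ℝ) (hF : ∀ i, ContDiff ℝ 1 fun x => F x i) {R : ℝ} (hR : 0 < R) :
    ∫ x, cutR R x * ∑ i, pd i (fun y => F y i) x
      = -∫ s in Set.Ioi (0 : ℝ), Dc s * flux F (R * s) := by
  have hc := cutR_contDiff R
  have hcs := cutR_compact hR
  have hpcs : ∀ i, HasCompactSupport (pd i (cutR R)) := fun i => hcs.fderiv_apply ℝ _
  have i1 : ∀ i, Integrable fun x => pd i (cutR R) x * F x i := fun i =>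
    ((pd_continuous hc i).mul (hF i).continuous).integrable_of_hasCompactSupport (hpcs i).mul_right
  have i2 : ∀ i, Integrable fun x => cutR R x * pd i (fun y => F y i) x := fun i =>
    (hc.continuous.mul (pd_continuous (hF i) i)).integrable_of_hasCompactSupport hcs.mul_right
  have i3 : ∀ i, Integrable fun x => cutR R x * F x i := fun i =>
    (hc.continuous.mul (hF i).continuous).integrable_of_hasCompactSupport hcs.mul_right
  have e1 : ∫ x, cutR R x * ∑ i, pd i (fun y => F y i) x
      = -∫ x, ∑ i, pd i (cutR R) x * F x i := by
    simp_rw [Finset.mul_sum]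
    rw [integral_finsetSum _ fun i _ => i2 i, integral_finsetSum _ fun i _ => i1 i,
      ← Finset.sum_neg_distrib]
    refine Finset.sum_congr rfl fun i _ => ?_
    exact integral_mul_fderiv_eq_neg_fderiv_mul_of_integrable (i1 i) (i2 i) (i3 i)
      (fun x _ => (hc.differentiable one_ne_zero) x)
      (fun x _ => ((hF i).differentiable one_ne_zero) x)
  rw [e1, polar_integral _ (integrable_finsetSum _ fun i _ => i1 i)]
  congr 1
  have e2 := integral_comp_mul_left_Ioi' (fun r => Dc (r / R) * R⁻¹ * flux F r) 0 hR
  have e3 : ∫ s in Set.Ioi (0 : ℝ), Dc s * flux F (R * s)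
      = R • ∫ s in Set.Ioi (0 : ℝ), Dc (R * s / R) * R⁻¹ * flux F (R * s) := by
    rw [smul_eq_mul, ← integral_const_mul]
    congr 1
    ext s
    rw [mul_div_cancel_left₀ _ hR.ne']
    field_simp
  rw [e3, e2, mul_zero]
  refine setIntegral_congr_fun measurableSet_Ioi fun r hr => ?_
  beta_reduce
  unfold flux
  rw [mul_left_comm, ← integral_const_mul (Dc (r / R) * R⁻¹)]
  congr 1
  refine integral_congr_ae (Eventually.of_forall fun ω => ?_)
  simp only [cutR_pd]
  have hω : ‖(ω : E3)‖ = 1 := by simp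
  rw [sum_sq_eq, norm_smul, hω, Finset.mul_sum]
  refine Finset.sum_congr rfl fun i _ => ?_
  unfold Dc
  simp only [PiLp.smul_apply, smul_eq_mul, mul_one, Real.norm_eq_abs, sq_abs, div_pow]
  ring

/-- Divergence theorem on all of space. -/
lemma div_thm (F : E3 → Fin 3 → ℝ) (hF : ∀ i, ContDiff ℝ 1 fun x => F x i) (L : ℝ)
    (hL : Tendsto (flux F) atTop (𝓝 L))
    (hint : Integrable fun x => ∑ i, pd i (fun y => F y i) x) :
    ∫ x, ∑ i, pd i (fun y => F y i) x = L := by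
  have h1 := (flux_avg F (fun i => (hF i).continuous) L hL).neg
  rw [neg_neg] at h1
  have h2 : Tendsto (fun R : ℝ => ∫ x, cutR R x * ∑ i, pd i (fun y => F y i) x) atTop (𝓝 L) := by
    refine h1.congr' ?_
    filter_upwards [eventually_gt_atTop 0] with R hR using (cutR_ibp F hF hR).symm
  refine tendsto_nhds_unique ?_ h2
  refine tendsto_integral_filter_of_dominated_convergence
    (fun x => ‖∑ i, pd i (fun y => F y i) x‖) ?_ ?_ hint.norm ?_
  · exact Eventually.of_forall fun R =>
      ((cutR_contDiff R).continuous.aestronglyMeasurable).mul hint.aestronglyMeasurable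
  · refine Eventually.of_forall fun R => Eventually.of_forall fun x => ?_
    rw [norm_mul]
    exact mul_le_of_le_one_left (norm_nonneg _) (cut_abs_le _)
  · refine Eventually.of_forall fun x => ?_
    refine tendsto_const_nhds.congr' ?_
    filter_upwards [eventually_ge_atTop ‖x‖, eventually_gt_atTop 0] with R hR hR0
    have : cutR R x = 1 := by
      apply cut_one
      rw [sum_sq_eq, div_le_one (by positivity)]
      gcongr
    rw [this, one_mul]

lemma pd_smooth {f : E3 → ℝ} (hf : ContDiff ℝ (⊤ : ℕ∞) f) (i : Fin 3) :
    ContDiff ℝ (⊤ : ℕ∞) (pd i f) := by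
  unfold pd
  exact (hf.fderiv_right (m := (⊤ : ℕ∞)) (by simp)).clm_apply contDiff_const

lemma sm_diff {f : E3 → ℝ} (hf : ContDiff ℝ (⊤ : ℕ∞) f) : Differentiable ℝ f :=
  hf.differentiable (by simp)

lemma pd_mul {f g : E3 → ℝ} (hf : ContDiff ℝ (⊤ : ℕ∞) f) (hg : ContDiff ℝ (⊤ : ℕ∞) g)
    (i : Fin 3) (x : E3) :
    pd i (fun y => f y * g y) x = f x * pd i g x + pd i f x * g x := by
  unfold pd
  rw [fderiv_fun_mul (sm_diff hf x) (sm_diff hg x)]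
  simp
  ring

lemma pd_sum {f : Fin 3 → E3 → ℝ} (hf : ∀ k, ContDiff ℝ (⊤ : ℕ∞) (f k))
    (i : Fin 3) (x : E3) :
    pd i (fun y => ∑ k, f k y) x = ∑ k, pd i (f k) x := by
  unfold pd
  rw [fderiv_fun_sum fun k _ => sm_diff (hf k) x]
  simp

lemma Khat_smooth {α : E3 → ℝ} {β : E3 → Fin 3 → ℝ} (hα : ∀ x, 0 < α x)
    (hαC : ContDiff ℝ (⊤ : ℕ∞) α) (hβC : ∀ i, ContDiff ℝ (⊤ : ℕ∞) fun x => β x i) (i l : Fin 3) :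
    ContDiff ℝ (⊤ : ℕ∞) (Khat α β i l) := by
  unfold Khat
  have hp : ∀ a b, ContDiff ℝ (⊤ : ℕ∞) (pd a (fun y => β y b)) := fun a b => pd_smooth (hβC b) a
  have h2 : ContDiff ℝ (⊤ : ℕ∞) fun x => 1 / (2 * α x) :=
    contDiff_const.div (contDiff_const.mul hαC) fun x => by have := hα x; positivity
  refine h2.mul (((hp i l).add (hp l i)).sub (contDiff_const.mul ?_))
  exact ContDiff.sum fun k _ => hp k k

lemma Khat_contr {α : E3 → ℝ} {β : E3 → Fin 3 → ℝ} (hα : ∀ x, 0 < α x) (x : E3) :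
    ∑ l, ∑ i, Khat α β i l x * pd l (fun y => β y i) x = α x * KK α β x := by
  have := (hα x).ne'
  simp only [KK, Khat, Fin.sum_univ_three]
  simp
  generalize α x = a at *
  generalize pd 0 (fun y => β y 0) x = b00
  generalize pd 0 (fun y => β y 1) x = b01
  generalize pd 0 (fun y => β y 2) x = b02
  generalize pd 1 (fun y => β y 0) x = b10
  generalize pd 1 (fun y => β y 1) x = b11
  generalize pd 1 (fun y => β y 2) x = b12
  generalize pd 2 (fun y => β y 0) x = b20
  generalize pd 2 (fun y => β y 1) x = b21
  generalize pd 2 (fun y => β y 2) x = b22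
  field_simp
  ring

lemma div_shift {α ψ : E3 → ℝ} {β j : E3 → Fin 3 → ℝ} (hα : ∀ x, 0 < α x)
    (hαC : ContDiff ℝ (⊤ : ℕ∞) α) (hψC : ContDiff ℝ (⊤ : ℕ∞) ψ)
    (hβC : ∀ i, ContDiff ℝ (⊤ : ℕ∞) fun x => β x i)
    (hmom : ∀ x : E3, ∀ i : Fin 3,
      (∑ l, pd l (fun y => ψ y ^ 6 * Khat α β i l y) x) = 8 * π * j x i * ψ x ^ 6) (x : E3) :
    ∑ l, pd l (fun y => ψ y ^ 6 * ∑ i, Khat α β i l y * β y i) x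
      = 8 * π * (ψ x ^ 6 * ∑ i, j x i * β x i) + α x * ψ x ^ 6 * KK α β x := by
  have hK := Khat_smooth hα hαC hβC
  have hψK : ∀ i l, ContDiff ℝ (⊤ : ℕ∞) fun y => ψ y ^ 6 * Khat α β i l y :=
    fun i l => (hψC.pow 6).mul (hK i l)
  have e : ∀ l, pd l (fun y => ψ y ^ 6 * ∑ i, Khat α β i l y * β y i) x
      = ψ x ^ 6 * (∑ i, Khat α β i l x * pd l (fun y => β y i) x)
        + ∑ i, pd l (fun y => ψ y ^ 6 * Khat α β i l y) x * β x i := by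
    intro l
    have : (fun y => ψ y ^ 6 * ∑ i, Khat α β i l y * β y i)
        = fun y => ∑ i, (ψ y ^ 6 * Khat α β i l y) * β y i := by
      ext y; rw [Finset.mul_sum]; simp only [mul_assoc]
    rw [this, pd_sum (f := fun i y => (ψ y ^ 6 * Khat α β i l y) * β y i)
      fun i => (hψK i l).mul (hβC i), Finset.mul_sum, ← Finset.sum_add_distrib]
    refine Finset.sum_congr rfl fun i _ => ?_
    rw [pd_mul (hψK i l) (hβC i)]
    ring
  simp_rw [e]
  rw [Finset.sum_add_distrib, ← Finset.mul_sum, Khat_contr hα, Finset.sum_comm]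
  simp_rw [← Finset.sum_mul, hmom]
  simp only [Fin.sum_univ_three]
  ring


/-- Mass-difference formula (Eq. eqdiff2 combined with eqid1):
`M_χ − M_ADM = 2 ∫ [ψ⁶ (j_k v^k + 3αP) − ½ ψ⁶ j_k β^k + (1/2π) ∇ψ·∇χ] dV`. -/
theorem iwm_mass_difference
    (α ψ : E3 → ℝ) (β j v : E3 → Fin 3 → ℝ) (ρH P : E3 → ℝ) (Mχ MADM : ℝ)
    (hα : ∀ x, 0 < α x) (hψ : ∀ x, 0 < ψ x)
    (hαC : ContDiff ℝ (⊤ : ℕ∞) α) (hψC : ContDiff ℝ (⊤ : ℕ∞) ψ)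
    (hβC : ∀ i, ContDiff ℝ (⊤ : ℕ∞) fun x => β x i)
    (hjC : ∀ i, ContDiff ℝ (⊤ : ℕ∞) fun x => j x i)
    (hvC : ∀ i, ContDiff ℝ (⊤ : ℕ∞) fun x => v x i)
    (hρHC : ContDiff ℝ (⊤ : ℕ∞) ρH) (hPC : ContDiff ℝ (⊤ : ℕ∞) P)
    (hjsupp : ∀ i, HasCompactSupport fun x => j x i)
    (hvsupp : ∀ i, HasCompactSupport fun x => v x i)
    (hρHsupp : HasCompactSupport ρH) (hPsupp : HasCompactSupport P)
    -- Hamiltonian constraint Δψ = −2π ψ⁵ ρ_H − (ψ⁵/8) K̂_i^j K̂_j^i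
    (hham : ∀ x : E3,
      lap ψ x = -(2 * π) * ψ x ^ 5 * ρH x - (ψ x ^ 5 / 8) * KK α β x)
    -- slicing equation Δχ = 2π χ ψ⁴ (ρ_H + 2S) + (7/8) χ ψ⁴ K̂_i^j K̂_j^i,
    -- with S = j_k (v^k + β^k)/α + 3P
    (hslice : ∀ x : E3,
      lap (chi α ψ) x
        = 2 * π * chi α ψ x * ψ x ^ 4
            * (ρH x + 2 * ((∑ k, j x k * (v x k + β x k)) / α x + 3 * P x))
          + (7 / 8) * chi α ψ x * ψ x ^ 4 * KK α β x)
    -- momentum constraint ∂_j(ψ⁶ K̂_i^j) = 8π j_i ψ⁶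
    (hmom : ∀ x : E3, ∀ i : Fin 3,
      (∑ l, pd l (fun y => ψ y ^ 6 * Khat α β i l y) x) = 8 * π * j x i * ψ x ^ 6)
    -- the flux limits defining M_χ and M_ADM exist
    (hMχ : Tendsto (fun r => (1 / (2 * π)) *
      flux (fun x i => ψ x * pd i (chi α ψ) x) r) atTop (𝓝 Mχ))
    (hMADM : Tendsto (fun r => -(1 / (2 * π)) *
      flux (fun x i => chi α ψ x * pd i ψ x) r) atTop (𝓝 MADM))
    -- the flux of ψ⁶ K̂_i^j β^i (in the index j) vanishes at infinity
    (hfluxβ : Tendsto (flux fun x l => ψ x ^ 6 * ∑ i, Khat α β i l x * β x i)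
      atTop (𝓝 0))
    -- integrability of the displayed integrands
    (hint1 : Integrable fun x => ψ x * lap (chi α ψ) x + ∑ i, pd i (chi α ψ) x * pd i ψ x)
    (hint2 : Integrable fun x => chi α ψ x * lap ψ x - ∑ i, pd i ψ x * pd i (chi α ψ) x)
    (hint3 : Integrable fun x => α x * ψ x ^ 6 * KK α β x)
    (hint4 : Integrable fun x => ψ x ^ 6 * ∑ i, j x i * β x i)
    (hint5 : Integrable fun x =>
      ∑ l, pd l (fun y => ψ y ^ 6 * ∑ i, Khat α β i l y * β y i) x)
    (hint6 : Integrable fun x : E3 =>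
      ψ x ^ 6 * ((∑ k, j x k * v x k) + 3 * α x * P x)
        - (1 / 2) * ψ x ^ 6 * (∑ k, j x k * β x k)
        + (1 / (2 * π)) * ∑ i, pd i ψ x * pd i (chi α ψ) x) :
    Mχ - MADM
      = 2 * ∫ x : E3,
          ψ x ^ 6 * ((∑ k, j x k * v x k) + 3 * α x * P x)
            - (1 / 2) * ψ x ^ 6 * (∑ k, j x k * β x k)
            + (1 / (2 * π)) * ∑ i, pd i ψ x * pd i (chi α ψ) x := by
  have hχC : ContDiff ℝ (⊤ : ℕ∞) (chi α ψ) := hαC.mul hψC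
  have hK := Khat_smooth hα hαC hβC
  have toC1 : ∀ {f : E3 → ℝ}, ContDiff ℝ (⊤ : ℕ∞) f → ContDiff ℝ 1 f :=
    fun h => h.of_le (by exact_mod_cast le_top)
  -- the three divergences
  have d1 : ∀ x, ∑ i, pd i (fun y => ψ y * pd i (chi α ψ) y) x
      = ψ x * lap (chi α ψ) x + ∑ i, pd i (chi α ψ) x * pd i ψ x := by
    intro x
    unfold lap
    rw [Finset.mul_sum, ← Finset.sum_add_distrib]
    refine Finset.sum_congr rfl fun i _ => ?_
    rw [pd_mul hψC (pd_smooth hχC i)]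
    ring
  have d2 : ∀ x, ∑ i, pd i (fun y => chi α ψ y * pd i ψ y) x
      = chi α ψ x * lap ψ x + ∑ i, pd i ψ x * pd i (chi α ψ) x := by
    intro x
    unfold lap
    rw [Finset.mul_sum, ← Finset.sum_add_distrib]
    refine Finset.sum_congr rfl fun i _ => ?_
    rw [pd_mul hχC (pd_smooth hψC i)]
    ring
  have d3 := div_shift hα hαC hψC hβC hmom
  -- integrability
  have iρ : Integrable fun x => α x * ψ x ^ 6 * ρH x :=
    ((hαC.continuous.mul (hψC.continuous.pow 6)).mul
      hρHC.continuous).integrable_of_hasCompactSupport hρHsupp.mul_left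
  have i4 : Integrable fun x => chi α ψ x * lap ψ x := by
    refine ((iρ.const_mul (-(2 * π))).sub (hint3.const_mul (1 / 8))).congr
      (Eventually.of_forall fun x => ?_)
    simp only [Pi.sub_apply, hham, chi]
    ring
  have iG : Integrable fun x => ∑ i, pd i ψ x * pd i (chi α ψ) x :=
    (i4.sub hint2).congr (Eventually.of_forall fun x => by simp only [Pi.sub_apply]; ring)
  have j1 : Integrable fun x => ∑ i, pd i (fun y => ψ y * pd i (chi α ψ) y) x := by
    simp_rw [d1]; exact hint1
  have j2 : Integrable fun x => ∑ i, pd i (fun y => chi α ψ y * pd i ψ y) x := by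
    simp_rw [d2]; exact i4.add iG
  -- limits of fluxes
  have hπ : (2 * π) ≠ 0 := by positivity
  have l1 : Tendsto (flux fun x i => ψ x * pd i (chi α ψ) x) atTop (𝓝 (2 * π * Mχ)) :=
    (hMχ.const_mul (2 * π)).congr fun r => by field_simp
  have l2 : Tendsto (flux fun x i => chi α ψ x * pd i ψ x) atTop (𝓝 (-(2 * π) * MADM)) :=
    (hMADM.const_mul (-(2 * π))).congr fun r => by field_simp
  have t1 := div_thm _ (fun i => toC1 (hψC.mul (pd_smooth hχC i))) _ l1 j1
  have t2 := div_thm _ (fun i => toC1 (hχC.mul (pd_smooth hψC i))) _ l2 j2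
  have t3 := div_thm (fun x l => ψ x ^ 6 * ∑ i, Khat α β i l x * β x i)
    (fun l => toC1 ((hψC.pow 6).mul (ContDiff.sum fun i _ => (hK i l).mul (hβC i)))) _ hfluxβ hint5
  -- pointwise combination
  have key : ∀ x, ψ x ^ 6 * ((∑ k, j x k * v x k) + 3 * α x * P x)
        - (1 / 2) * ψ x ^ 6 * (∑ k, j x k * β x k)
        + (1 / (2 * π)) * ∑ i, pd i ψ x * pd i (chi α ψ) x
      = (1 / (4 * π)) * ((∑ i, pd i (fun y => ψ y * pd i (chi α ψ) y) x)
          + ∑ i, pd i (fun y => chi α ψ y * pd i ψ y) x)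
        - (3 / (16 * π)) * ∑ l, pd l (fun y => ψ y ^ 6 * ∑ i, Khat α β i l y * β y i) x := by
    intro x
    have ha := (hα x).ne'
    rw [d1, d2, d3, hham, hslice]
    simp only [chi, mul_add, Finset.sum_add_distrib]
    rw [show ∑ i, pd i (chi α ψ) x * pd i ψ x = ∑ i, pd i ψ x * pd i (chi α ψ) x from
      Finset.sum_congr rfl fun i _ => mul_comm _ _]
    generalize ∑ i, pd i ψ x * pd i (chi α ψ) x = G
    generalize ∑ k, j x k * v x k = A
    generalize ∑ k, j x k * β x k = B
    generalize KK α β x = Q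
    field_simp
    ring
  simp_rw [key]
  have j12 : Integrable fun x => (∑ i, pd i (fun y => ψ y * pd i (chi α ψ) y) x)
      + ∑ i, pd i (fun y => chi α ψ y * pd i ψ y) x := j1.add j2
  rw [integral_sub (j12.const_mul _) (hint5.const_mul _), integral_const_mul,
    integral_const_mul, integral_add j1 j2, t1, t2, t3]
  field_simp
  ring
end
end
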